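/- arXiv:1501.05248 — 2 statements merged into one kernel-verified Lean document; each statement's English description precedes it below -/
import Mathlib

section
/- Define θ : (0,∞) → ℝ by θ(r) = (360/121)(11/5)^{1/6} r^{-1} - 25/11 for 0 < r ≤ (11/5)^{1/6} and θ(r) = -r^{-12} + 2r^{-6} for r > (11/5)^{1/6}. Then θ(r) ≥ 0 for all r > 0, the radial extension Θ(x) = θ(‖x‖) is C² on ℝ³ \ {0}, and Θ is subharmonic there (its Laplacian is 0 for ‖x‖ ≤ (11/5)^{1/6} and ≥ 0 otherwise). -/
open MeasureTheory

theorem exists_linearIsometryEquiv_apply_eq {E F : Type*} [NormedAddCommGroup E]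
    [InnerProductSpace ℝ E] [FiniteDimensional ℝ E] [NormedAddCommGroup F]
    [InnerProductSpace ℝ F] [FiniteDimensional ℝ F]
    (h : Module.finrank ℝ E = Module.finrank ℝ F) {x : E} {y : F} (hxy : ‖x‖ = ‖y‖) :
    ∃ e : E ≃ₗᵢ[ℝ] F, e x = y := by
  let e := (stdOrthonormalBasis ℝ E).equiv (stdOrthonormalBasis ℝ F) (finCongr h)
  refine ⟨e.trans (ℝ ∙ (e x - y))ᗮ.reflection, ?_⟩
  simpa using Submodule.reflection_sub (v := e x) (w := y) (by simpa using hxy)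

/-- The integral of `1 / r` over the planar disc of radius `√(R² - (z - a)²)` at height `z`. -/
theorem integral_complex_slice {a R z : ℝ} (hz : 0 < z) (h : (z - a) ^ 2 ≤ R ^ 2) :
    ∫ u : ℂ, (if (z - a) ^ 2 + ‖u‖ ^ 2 ≤ R ^ 2 then (√(z ^ 2 + ‖u‖ ^ 2))⁻¹ else 0) =
      2 * Real.pi * (√(R ^ 2 - a ^ 2 + 2 * a * z) - z) := by
  have key := integral_fun_norm_addHaar (volume : Measure ℂ)
    (fun ρ : ℝ => if (z - a) ^ 2 + ρ ^ 2 ≤ R ^ 2 then (√(z ^ 2 + ρ ^ 2))⁻¹ else 0)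
  rw [key]
  set m := √(R ^ 2 - (z - a) ^ 2)
  have hm2 : m ^ 2 = R ^ 2 - (z - a) ^ 2 := Real.sq_sqrt (by linarith)
  have hm0 : 0 ≤ m := Real.sqrt_nonneg _
  have h1 : ∫ ρ in Set.Ioi (0 : ℝ), ρ ^ (Module.finrank ℝ ℂ - 1) •
      (if (z - a) ^ 2 + ρ ^ 2 ≤ R ^ 2 then (√(z ^ 2 + ρ ^ 2))⁻¹ else 0) =
      ∫ ρ in (0 : ℝ)..m, ρ * (√(z ^ 2 + ρ ^ 2))⁻¹ := by
    rw [intervalIntegral.integral_of_le hm0, ← integral_indicator measurableSet_Ioi,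
      ← integral_indicator measurableSet_Ioc]
    congr 1
    ext ρ
    by_cases h0 : 0 < ρ
    · have : (z - a) ^ 2 + ρ ^ 2 ≤ R ^ 2 ↔ ρ ≤ m := by
        rw [← sq_le_sq₀ h0.le hm0, hm2]
        constructor <;> intro <;> linarith
      simp [Set.indicator, h0, this]
    · simp [Set.indicator, h0]
  have h2 : ∫ ρ in (0 : ℝ)..m, ρ * (√(z ^ 2 + ρ ^ 2))⁻¹ = √(z ^ 2 + m ^ 2) - z := by
    have hpos (ρ : ℝ) : z ^ 2 + ρ ^ 2 ≠ 0 := by positivity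
    rw [intervalIntegral.integral_eq_sub_of_hasDerivAt (f := fun ρ => √(z ^ 2 + ρ ^ 2))]
    · simp [Real.sqrt_sq hz.le]
    · intro ρ _
      refine (((hasDerivAt_id' ρ).pow 2).const_add (z ^ 2)).sqrt (hpos ρ) |>.congr_deriv ?_
      simp only [Nat.cast_ofNat, Nat.add_one_sub_one, pow_one, mul_one, Pi.pow_apply]
      field_simp
    · apply Continuous.intervalIntegrable
      have (ρ : ℝ) : √(z ^ 2 + ρ ^ 2) ≠ 0 := by positivity
      fun_prop (disch := assumption)
  rw [h1, h2, hm2]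
  have h3 : z ^ 2 + (R ^ 2 - (z - a) ^ 2) = R ^ 2 - a ^ 2 + 2 * a * z := by ring
  rw [h3]
  simp [Measure.real, mul_assoc]

theorem integral_sqrt_sub_id {a R : ℝ} (hR : 0 < R) (ha : R < a) :
    ∫ z in (a - R)..(a + R), (√(R ^ 2 - a ^ 2 + 2 * a * z) - z) = 2 * R ^ 3 / (3 * a) := by
  have ha0 : 0 < a := hR.trans ha
  have hpos : ∀ z ∈ Set.uIcc (a - R) (a + R), 0 < R ^ 2 - a ^ 2 + 2 * a * z := by
    intro z hz
    rw [Set.uIcc_of_le (by linarith)] at hz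
    nlinarith [hz.1, mul_pos (sub_pos.2 ha) (sub_pos.2 ha)]
  rw [intervalIntegral.integral_eq_sub_of_hasDerivAt (f := fun z =>
    (R ^ 2 - a ^ 2 + 2 * a * z) * √(R ^ 2 - a ^ 2 + 2 * a * z) / (3 * a) - z ^ 2 / 2)]
  · have e1 : R ^ 2 - a ^ 2 + 2 * a * (a + R) = (a + R) ^ 2 := by ring
    have e2 : R ^ 2 - a ^ 2 + 2 * a * (a - R) = (a - R) ^ 2 := by ring
    simp only [e1, e2]
    rw [Real.sqrt_sq (by linarith), Real.sqrt_sq (by linarith)]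
    field_simp
    ring
  · intro z hz
    have hw := hpos z hz
    have hl : HasDerivAt (fun z => R ^ 2 - a ^ 2 + 2 * a * z) (2 * a) z := by
      simpa using ((hasDerivAt_id z).const_mul (2 * a)).const_add (R ^ 2 - a ^ 2)
    refine (((hl.mul (hl.sqrt hw.ne')).div_const (3 * a)).sub
      (((hasDerivAt_id' z).pow 2).div_const 2)).congr_deriv ?_
    have hs := Real.sq_sqrt hw.le
    have hs0 : √(R ^ 2 - a ^ 2 + 2 * a * z) ≠ 0 := (Real.sqrt_pos.2 hw).ne'
    generalize √(R ^ 2 - a ^ 2 + 2 * a * z) = s at *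
    rw [← hs]
    field_simp
    norm_num
    ring
  · apply Continuous.intervalIntegrable
    fun_prop

theorem setIntegral_closedBall_inv_norm {x : EuclideanSpace ℝ (Fin 3)} {R : ℝ} (hR : 0 < R)
    (hx : R < ‖x‖) :
    ∫ y in Metric.closedBall x R, ‖y‖⁻¹ =
      volume.real (Metric.closedBall x R) * ‖x‖⁻¹ := by
  set a := ‖x‖
  obtain ⟨e, he⟩ := exists_linearIsometryEquiv_apply_eq
    (F := WithLp 2 (ℝ × ℂ)) (x := x) (y := WithLp.toLp 2 (a, 0))
    ((finrank_euclideanSpace_fin).trans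
      (by rw [(WithLp.linearEquiv 2 ℝ (ℝ × ℂ)).finrank_eq]; simp))
    (by simp [a])
  let T : EuclideanSpace ℝ (Fin 3) → ℝ × ℂ := fun y => WithLp.ofLp (e y)
  have hT : MeasurePreserving T :=
    (WithLp.volume_preserving_ofLp ℝ ℂ).comp e.measurePreserving
  have hTe : MeasurableEmbedding T :=
    (e.toMeasurableEquiv.trans (MeasurableEquiv.toLp 2 (ℝ × ℂ)).symm).measurableEmbedding
  let S : Set (ℝ × ℂ) := {p | (p.1 - a) ^ 2 + ‖p.2‖ ^ 2 ≤ R ^ 2}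
  have hS : MeasurableSet S := (isClosed_le (by fun_prop) (by fun_prop)).measurableSet
  have hTS : T ⁻¹' S = Metric.closedBall x R := by
    ext y
    rw [Metric.mem_closedBall, ← e.dist_map, dist_eq_norm, he, WithLp.prod_norm_eq_of_L2,
      Real.sqrt_le_left hR.le]
    simp [S, T]
  have hTn (y) : ‖y‖⁻¹ = (√((T y).1 ^ 2 + ‖(T y).2‖ ^ 2))⁻¹ := by
    rw [← e.norm_map, WithLp.prod_norm_eq_of_L2]
    simp [T]
  have hint : IntegrableOn (fun p : ℝ × ℂ => (√(p.1 ^ 2 + ‖p.2‖ ^ 2))⁻¹) S := by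
    rw [← hT.integrableOn_comp_preimage hTe, hTS]
    refine ContinuousOn.integrableOn_compact (isCompact_closedBall x R) ?_
    refine (continuousOn_id.norm.inv₀ fun y hy h0 => ?_).congr fun y _ => (hTn y).symm
    have hy0 : y = 0 := norm_eq_zero.1 h0
    simp [hy0] at hy
    linarith
  have hvol : volume.real (Metric.closedBall x R) = 4 / 3 * Real.pi * R ^ 3 := by
    rw [Measure.real, EuclideanSpace.volume_closedBall_fin_three]
    rw [ENNReal.toReal_mul, ENNReal.toReal_pow, ENNReal.toReal_ofReal hR.le,
      ENNReal.toReal_ofReal (by positivity)]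
    ring
  simp_rw [hTn]
  rw [← hTS, hT.setIntegral_preimage_emb hTe (fun p => (√(p.1 ^ 2 + ‖p.2‖ ^ 2))⁻¹),
    ← integral_indicator hS, Measure.volume_eq_prod,
    integral_prod _ ((integrable_indicator_iff hS).2 hint), hTS, hvol]
  have hslice : (fun z : ℝ => ∫ u : ℂ, S.indicator (fun p => (√(p.1 ^ 2 + ‖p.2‖ ^ 2))⁻¹) (z, u)) =
      (Set.Icc (a - R) (a + R)).indicator
        (fun z => 2 * Real.pi * (√(R ^ 2 - a ^ 2 + 2 * a * z) - z)) := by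
    ext z
    by_cases hz : z ∈ Set.Icc (a - R) (a + R)
    · rw [Set.indicator_of_mem hz, ← integral_complex_slice (by linarith [hz.1])
        (sq_le_sq' (by linarith [hz.1]) (by linarith [hz.2]))]
      simp [Set.indicator, S]
    · rw [Set.indicator_of_notMem hz]
      refine integral_eq_zero_of_ae (.of_forall fun u => Set.indicator_of_notMem ?_ _)
      intro hu
      have : (z - a) ^ 2 ≤ R ^ 2 := by exact (le_add_of_nonneg_right (sq_nonneg ‖u‖)).trans hu
      have := abs_le_of_sq_le_sq' this hR.le
      exact hz ⟨by linarith [this.1], by linarith [this.2]⟩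
  rw [hslice, integral_indicator measurableSet_Icc, integral_Icc_eq_integral_Ioc,
    ← intervalIntegral.integral_of_le (by linarith), intervalIntegral.integral_const_mul,
    integral_sqrt_sub_id hR hx]
  field_simp
  ring

theorem hasDerivAt_ite_lt {f g f' g' : ℝ → ℝ} {b : ℝ} (hf : ∀ t, HasDerivAt f (f' t) t)
    (hg : ∀ t, HasDerivAt g (g' t) t) (h : f b = g b) (h' : f' b = g' b) (t : ℝ) :
    HasDerivAt (fun t => if t < b then f t else g t) (if t < b then f' t else g' t) t := by
  rcases lt_trichotomy t b with ht | rfl | ht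
  · rw [if_pos ht]
    refine (hf t).congr_of_eventuallyEq ?_
    filter_upwards [eventually_lt_nhds ht] with u hu using if_pos hu
  · rw [if_neg (lt_irrefl t), ← hasDerivWithinAt_univ, ← Set.Iic_union_Ici (a := t)]
    refine HasDerivWithinAt.union ?_ ?_
    · rw [← h']
      refine (hf t).hasDerivWithinAt.congr (fun u hu => ?_) (by simp [h])
      rcases (Set.mem_Iic.1 hu).lt_or_eq with hu | rfl
      · exact if_pos hu
      · simp [h]
    · exact (hg t).hasDerivWithinAt.congr (fun u hu => if_neg (not_lt.2 hu)) (by simp)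
  · rw [if_neg ht.not_gt]
    refine (hg t).congr_of_eventuallyEq ?_
    filter_upwards [eventually_gt_nhds ht] with u hu using if_neg hu.not_gt

/-- The profile `θ` as a function of `t = r⁻¹`, with matching radius `s`. -/
noncomputable def inverseProfile (s t : ℝ) : ℝ :=
  if t < s⁻¹ then -t ^ 12 + 2 * t ^ 6 else 360 / 121 * s * t - 25 / 11

section inverseProfile

variable {s : ℝ}

theorem hasDerivAt_inverseProfile (hs : 0 < s) (hs6 : s ^ 6 = 11 / 5) (t : ℝ) :
    HasDerivAt (inverseProfile s)
      (if t < s⁻¹ then -12 * t ^ 11 + 12 * t ^ 5 else 360 / 121 * s) t := by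
  have h12 : s ^ 12 = (11 / 5) ^ 2 := by rw [← hs6]; ring
  refine hasDerivAt_ite_lt (f' := fun t => -12 * t ^ 11 + 12 * t ^ 5)
    (g' := fun _ => 360 / 121 * s) (fun t => ?_) (fun t => ?_) ?_ ?_ t
  · refine ((hasDerivAt_pow 12 t).neg.add ((hasDerivAt_pow 6 t).const_mul 2)).congr_deriv ?_
    norm_num
    ring
  · simpa using ((hasDerivAt_id t).const_mul (360 / 121 * s)).sub_const (25 / 11)
  · simp only [inv_pow, h12, hs6]
    field_simp
    norm_num
  · have h1 : s⁻¹ ^ 5 = s * 5 / 11 := by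
      field_simp
      linarith
    have h2 : s⁻¹ ^ 11 = s * 25 / 121 := by
      field_simp
      linarith
    simp only [h1, h2]
    ring

theorem hasDerivAt_deriv_inverseProfile (hs : 0 < s) (hs6 : s ^ 6 = 11 / 5) (t : ℝ) :
    HasDerivAt (deriv (inverseProfile s))
      (if t < s⁻¹ then -132 * t ^ 10 + 60 * t ^ 4 else 0) t := by
  rw [show deriv (inverseProfile s) = _ from
    funext fun t => (hasDerivAt_inverseProfile hs hs6 t).deriv]
  refine hasDerivAt_ite_lt (f := fun t => -12 * t ^ 11 + 12 * t ^ 5)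
    (f' := fun t => -132 * t ^ 10 + 60 * t ^ 4)
    (g := fun _ => 360 / 121 * s) (g' := fun _ => 0) (fun t => ?_) (fun t => ?_) ?_ ?_ t
  · refine (((hasDerivAt_pow 11 t).const_mul (-12)).add
      ((hasDerivAt_pow 5 t).const_mul 12)).congr_deriv ?_
    norm_num
    ring
  · exact hasDerivAt_const t _
  · have h1 : s⁻¹ ^ 5 = s * 5 / 11 := by
      field_simp
      linarith
    have h2 : s⁻¹ ^ 11 = s * 25 / 121 := by
      have h12 : s ^ 12 = (11 / 5) ^ 2 := by rw [← hs6]; ring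
      field_simp
      linarith
    simp only [h1, h2]
    ring
  · have h10 : s⁻¹ ^ 10 = s⁻¹ ^ 4 * (s ^ 6)⁻¹ := by
      field_simp
    simp only [h10, hs6]
    ring

theorem contDiff_inverseProfile (hs : 0 < s) (hs6 : s ^ 6 = 11 / 5) :
    ContDiff ℝ 2 (inverseProfile s) := by
  rw [show (2 : WithTop ℕ∞) = 1 + 1 by norm_num, contDiff_succ_iff_deriv]
  refine ⟨fun t => (hasDerivAt_inverseProfile hs hs6 t).differentiableAt, by simp, ?_⟩
  rw [contDiff_one_iff_deriv]
  refine ⟨fun t => (hasDerivAt_deriv_inverseProfile hs hs6 t).differentiableAt, ?_⟩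
  rw [show deriv (deriv (inverseProfile s)) = _ from
    funext fun t => (hasDerivAt_deriv_inverseProfile hs hs6 t).deriv]
  have h10 : s⁻¹ ^ 10 = s⁻¹ ^ 4 * (s ^ 6)⁻¹ := by
    field_simp
  simp only [← not_le, ite_not]
  refine Continuous.if_le (by fun_prop) (by fun_prop) continuous_const continuous_id ?_
  rintro t rfl
  rw [h10, hs6]
  ring

theorem convexOn_inverseProfile (hs : 0 < s) (hs6 : s ^ 6 = 11 / 5) :
    ConvexOn ℝ (Set.Ici 0) (inverseProfile s) := by
  refine convexOn_of_deriv2_nonneg' (convex_Ici 0)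
    (fun t _ => (hasDerivAt_inverseProfile hs hs6 t).differentiableAt.differentiableWithinAt)
    (fun t _ => (hasDerivAt_deriv_inverseProfile hs hs6 t).differentiableAt.differentiableWithinAt)
    fun t ht => ?_
  simp only [Function.iterate_succ, Function.iterate_zero, Function.comp_apply, id]
  rw [(hasDerivAt_deriv_inverseProfile hs hs6 t).deriv]
  split_ifs with h
  · have h6 : t ^ 6 ≤ 5 / 11 := by
      have := pow_le_pow_left₀ ht h.le 6
      rw [inv_pow, hs6] at this
      linarith
    have : -132 * t ^ 10 + 60 * t ^ 4 = t ^ 4 * (60 - 132 * t ^ 6) := by ring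
    rw [this]
    exact mul_nonneg (by positivity) (by linarith)
  · rfl

theorem inverseProfile_nonneg (hs : 0 < s) (hs6 : s ^ 6 = 11 / 5) {t : ℝ} (ht : 0 ≤ t) :
    0 ≤ inverseProfile s t := by
  unfold inverseProfile
  split_ifs with h
  · have h6 : t ^ 6 ≤ 5 / 11 := by
      have := pow_le_pow_left₀ ht h.le 6
      rw [inv_pow, hs6] at this
      linarith
    have : -t ^ 12 + 2 * t ^ 6 = t ^ 6 * (2 - t ^ 6) := by ring
    rw [this]
    exact mul_nonneg (by positivity) (by linarith)
  · have : 1 ≤ s * t := (inv_le_iff_one_le_mul₀' hs).1 (not_lt.1 h)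
    linarith

end inverseProfile

theorem stmt_9 (θ : ℝ → ℝ)
    (hθ₁ : ∀ r : ℝ, 0 < r → r ≤ (11/5 : ℝ) ^ ((1:ℝ)/6) →
      θ r = (360/121) * (11/5 : ℝ) ^ ((1:ℝ)/6) * r⁻¹ - 25/11)
    (hθ₂ : ∀ r : ℝ, (11/5 : ℝ) ^ ((1:ℝ)/6) < r → θ r = -r ^ (-12 : ℤ) + 2 * r ^ (-6 : ℤ)) :
    (∀ r : ℝ, 0 < r → 0 ≤ θ r) ∧
    ContDiffOn ℝ 2 (fun x : EuclideanSpace ℝ (Fin 3) => θ ‖x‖) {x | x ≠ 0} ∧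
    (∀ x : EuclideanSpace ℝ (Fin 3), x ≠ 0 → ∀ R : ℝ, 0 < R →
      (0 : EuclideanSpace ℝ (Fin 3)) ∉ Metric.closedBall x R →
      θ ‖x‖ ≤ ⨍ y in Metric.closedBall x R, θ ‖y‖) := by
  have hs6 : ((11/5 : ℝ) ^ ((1:ℝ)/6)) ^ 6 = 11 / 5 := by
    rw [← Real.rpow_natCast, ← Real.rpow_mul (by norm_num)]
    norm_num
  have hs : 0 < (11/5 : ℝ) ^ ((1:ℝ)/6) := by positivity
  generalize (11/5 : ℝ) ^ ((1:ℝ)/6) = s at *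
  have hθ : ∀ r, 0 < r → θ r = inverseProfile s r⁻¹ := by
    intro r hr
    unfold inverseProfile
    rcases le_or_gt r s with h | h
    · rw [hθ₁ r hr h, if_neg (not_lt.2 (inv_anti₀ hr h))]
    · rw [hθ₂ r h, if_pos (inv_strictAnti₀ hs h), zpow_neg, zpow_neg, inv_pow, inv_pow]
      norm_cast
  have hsmooth := contDiff_inverseProfile hs hs6
  refine ⟨fun r hr => hθ r hr ▸ inverseProfile_nonneg hs hs6 (by positivity), ?_, ?_⟩
  · refine ContDiffOn.congr (f := fun x => inverseProfile s ‖x‖⁻¹) ?_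
      fun x hx => hθ _ (norm_pos_iff.2 hx)
    refine hsmooth.comp_contDiffOn fun x hx => ContDiffAt.contDiffWithinAt ?_
    exact (contDiffAt_norm ℝ hx).inv (norm_ne_zero_iff.2 hx)
  · intro x hx R hR h0
    have hRx : R < ‖x‖ := by simpa using h0
    have hne : ∀ y ∈ Metric.closedBall x R, y ≠ 0 := fun y hy h => h0 (h ▸ hy)
    have hvol : volume.real (Metric.closedBall x R) ≠ 0 :=
      (ENNReal.toReal_pos (Metric.measure_closedBall_pos _ _ hR).ne'
        measure_closedBall_lt_top.ne).ne'
    have hinv : ContinuousOn (fun y : EuclideanSpace ℝ (Fin 3) => ‖y‖⁻¹)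
        (Metric.closedBall x R) :=
      continuousOn_id.norm.inv₀ fun y hy => norm_ne_zero_iff.2 (hne y hy)
    have hmean : ⨍ y in Metric.closedBall x R, ‖y‖⁻¹ = ‖x‖⁻¹ := by
      rw [setAverage_eq, setIntegral_closedBall_inv_norm hR hRx, smul_eq_mul,
        inv_mul_cancel_left₀ hvol]
    have hjensen := (convexOn_inverseProfile hs hs6).map_set_average_le
      (μ := volume) (t := Metric.closedBall x R) (f := fun y => ‖y‖⁻¹)
      hsmooth.continuous.continuousOn isClosed_Ici
      (Metric.measure_closedBall_pos _ _ hR).ne' measure_closedBall_lt_top.ne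
      (.of_forall fun y => Set.mem_Ici.2 (by positivity))
      (hinv.integrableOn_compact (isCompact_closedBall x R))
      ((hsmooth.continuous.comp_continuousOn hinv).integrableOn_compact
        (isCompact_closedBall x R))
    rw [hmean, ← hθ _ (norm_pos_iff.2 hx)] at hjensen
    refine hjensen.trans_eq ?_
    rw [setAverage_eq, setAverage_eq]
    congr 1
    exact setIntegral_congr_fun Metric.isClosed_closedBall.measurableSet
      fun y hy => (hθ _ (norm_pos_iff.2 (hne y hy))).symm
end

section
/- For every finite set Q ⊂ ℝ³ with pairwise distances at least a, where 0 < a ≤ 0.7, and every x ∈ ℝ³ with x ∉ Q (or treating the point 0 with Q not containing 0), one has ∑_{x ∈ Q} h(‖x‖) ≤ (24/a³) ∫_{0.54}^∞ θ(w) w² dw < 26.95/a³, where h(r) = -r^{-12} + 2r^{-6} and θ is the piecewise radial profile matching h beyond (11/5)^{1/6} and equal to (360/121)(11/5)^{1/6} r^{-1} - 25/11 below it. -/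
open MeasureTheory

lemma exists_measurableEquiv_real_prod_complex (x : EuclideanSpace ℝ (Fin 3)) (hx : x ≠ 0) :
    ∃ e : EuclideanSpace ℝ (Fin 3) ≃ᵐ ℝ × ℂ, MeasurePreserving e ∧
      (∀ y, ‖y‖ ^ 2 = (e y).1 ^ 2 + ‖(e y).2‖ ^ 2) ∧
      ∀ y, ‖y - x‖ ^ 2 = ((e y).1 - ‖x‖) ^ 2 + ‖(e y).2‖ ^ 2 := by
  have hx' : ‖x‖ ≠ 0 := norm_ne_zero_iff.2 hx
  obtain ⟨b, hb⟩ := Orthonormal.exists_orthonormalBasis_extension_of_card_eq (𝕜 := ℝ)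
    (E := EuclideanSpace ℝ (Fin 3)) (ι := Fin 3) (by simp)
    (v := fun _ => ‖x‖⁻¹ • x) (s := {0}) (by
      constructor
      · intro i
        simp [norm_smul, hx']
      · intro i j hij
        exact absurd (Subsingleton.elim i j) hij)
  have hbx : b 0 = ‖x‖⁻¹ • x := hb 0 rfl
  have hxb : x = ‖x‖ • b 0 := by rw [hbx, smul_smul, mul_inv_cancel₀ hx', one_smul]
  let e : EuclideanSpace ℝ (Fin 3) ≃ᵐ ℝ × ℂ :=
    b.measurableEquiv.trans <| (MeasurableEquiv.toLp 2 (Fin 3 → ℝ)).symm.trans <|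
      (MeasurableEquiv.piFinSuccAbove (fun _ => ℝ) 0).trans <|
        (MeasurableEquiv.refl ℝ).prodCongr Complex.measurableEquivPi.symm
  have he : ∀ y, e y = (b.repr y 0, ⟨b.repr y 1, b.repr y 2⟩) := fun y =>
    Prod.ext rfl ((Complex.measurableEquivPi_symm_apply
      (fun i => b.repr y (Fin.succAbove 0 i))).trans (by apply Complex.ext <;> simp))
  refine ⟨e, ?_, ?_, ?_⟩
  · have h₁ := b.measurePreserving_measurableEquiv
    have h₂ := PiLp.volume_preserving_ofLp (Fin 3)
    have h₃ := volume_preserving_piFinSuccAbove (fun _ : Fin 3 => ℝ) 0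
    have h₄ := (MeasurePreserving.id (volume : Measure ℝ)).prod
      (Complex.volume_preserving_equiv_pi.symm)
    exact h₄.comp (h₃.comp (h₂.comp h₁))
  · intro y
    rw [← b.repr.norm_map y, EuclideanSpace.norm_sq_eq, he, Complex.sq_norm, Complex.normSq_apply]
    simp [Fin.sum_univ_three]; ring
  · intro y
    have h0 : b.repr x = ‖x‖ • EuclideanSpace.single 0 1 := by
      conv_lhs => rw [hxb]
      simp
    rw [← b.repr.norm_map, EuclideanSpace.norm_sq_eq, he, Complex.sq_norm, Complex.normSq_apply,
      map_sub, h0]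
    simp [Fin.sum_univ_three]; ring

lemma integral_complex_inv_sqrt {t s : ℝ} (ht : 0 < t) :
    ∫ z : ℂ, (if ‖z‖ ^ 2 < s then (√(t ^ 2 + ‖z‖ ^ 2))⁻¹ else 0) =
      if 0 < s then 2 * Real.pi * (√(t ^ 2 + s) - t) else 0 := by
  rw [integral_fun_norm_addHaar volume
    (fun r : ℝ => if r ^ 2 < s then (√(t ^ 2 + r ^ 2))⁻¹ else 0)]
  have hvol : (volume : Measure ℂ).real (Metric.ball 0 1) = Real.pi := by
    simp [Measure.real, Complex.volume_ball]
  rw [hvol, Complex.finrank_real_complex]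
  split_ifs with hs
  · have h1 : ∫ y in Set.Ioi (0 : ℝ), y ^ (2 - 1) •
        (if y ^ 2 < s then (√(t ^ 2 + y ^ 2))⁻¹ else 0) =
        ∫ y in Set.Ioo 0 (√s), y * (√(t ^ 2 + y ^ 2))⁻¹ := by
      rw [← integral_indicator measurableSet_Ioi, ← integral_indicator measurableSet_Ioo]
      congr 1
      ext y
      by_cases hy : 0 < y
      · by_cases hys : y ^ 2 < s
        · have : y < √s := Real.lt_sqrt_of_sq_lt hys
          simp [Set.indicator, *]
        · have : ¬ y < √s := fun h => hys ((Real.lt_sqrt hy.le).1 h)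
          simp [Set.indicator, *]
      · simp [Set.indicator, *]
    have h2 : ∫ y in (0:ℝ)..√s, y * (√(t ^ 2 + y ^ 2))⁻¹ =
        √(t ^ 2 + √s ^ 2) - √(t ^ 2 + 0 ^ 2) := by
      refine intervalIntegral.integral_eq_sub_of_hasDerivAt (f := fun y => √(t ^ 2 + y ^ 2))
        (fun y _ => ?_) ?_
      · have := (((hasDerivAt_pow 2 y).const_add (t ^ 2)).sqrt (by positivity))
        refine this.congr_deriv ?_
        field_simp
        simp
      · refine Continuous.intervalIntegrable ?_ _ _
        exact continuous_id.mul (Continuous.inv₀ (by fun_prop) (fun y => by positivity))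
    rw [h1, ← integral_Ioc_eq_integral_Ioo, ← intervalIntegral.integral_of_le (by positivity), h2,
      Real.sq_sqrt hs.le]
    simp [Real.sqrt_sq ht.le]; ring
  · have : ∀ y : ℝ, ¬ y ^ 2 < s := fun y => by nlinarith [sq_nonneg y]
    simp [this]

lemma integrableOn_ball_inv_norm {x : EuclideanSpace ℝ (Fin 3)} {ρ : ℝ} (hx : ρ < ‖x‖) :
    IntegrableOn (fun y : EuclideanSpace ℝ (Fin 3) => ‖y‖⁻¹) (Metric.ball x ρ) := by
  refine IntegrableOn.mono_set ?_ Metric.ball_subset_closedBall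
  refine ContinuousOn.integrableOn_compact (isCompact_closedBall x ρ) ?_
  refine continuous_norm.continuousOn.inv₀ fun y hy => ?_
  rw [mem_closedBall_iff_norm'] at hy
  have := norm_sub_norm_le x y
  intro h0
  linarith

lemma setIntegral_ball_inv_norm {x : EuclideanSpace ℝ (Fin 3)} {ρ : ℝ} (hρ : 0 < ρ)
    (hx : ρ < ‖x‖) :
    ∫ y in Metric.ball x ρ, ‖y‖⁻¹ = 4 / 3 * Real.pi * ρ ^ 3 * ‖x‖⁻¹ := by
  have hx0 : x ≠ 0 := norm_pos_iff.1 (hρ.trans hx)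
  obtain ⟨e, he, hn, hd⟩ := exists_measurableEquiv_real_prod_complex x hx0
  set R := ‖x‖
  have hR : 0 < R := hρ.trans hx
  let F : ℝ × ℂ → ℝ := fun p =>
    if ‖p.2‖ ^ 2 < ρ ^ 2 - (p.1 - R) ^ 2 then (√(p.1 ^ 2 + ‖p.2‖ ^ 2))⁻¹ else 0
  have hF : (Metric.ball x ρ).indicator (fun y => ‖y‖⁻¹) = F ∘ e := by
    ext y
    have hy : y ∈ Metric.ball x ρ ↔ ‖(e y).2‖ ^ 2 < ρ ^ 2 - ((e y).1 - R) ^ 2 := by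
      rw [mem_ball_iff_norm, ← sq_lt_sq₀ (norm_nonneg _) hρ.le, hd]
      constructor <;> intro h <;> linarith
    simp only [Set.indicator, hy, Function.comp, F, ← hn, Real.sqrt_sq (norm_nonneg y)]
  have hint := integrableOn_ball_inv_norm hx
  have hFint : Integrable F (volume.prod volume) := by
    rw [← integrable_indicator_iff measurableSet_ball, hF] at hint
    exact (he.integrable_comp_emb e.measurableEmbedding).1 hint
  rw [← integral_indicator measurableSet_ball, hF]
  have h1 : ∫ y, (F ∘ e) y = ∫ p, F p ∂(volume.prod volume) :=
    he.integral_comp e.measurableEmbedding F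
  rw [h1, integral_prod _ hFint]
  have h2 : ∀ t : ℝ, ∫ z : ℂ, F (t, z) = (Set.Ioo (R - ρ) (R + ρ)).indicator
      (fun t => 2 * Real.pi * (√(ρ ^ 2 - R ^ 2 + 2 * R * t) - t)) t := by
    intro t
    by_cases ht : t ∈ Set.Ioo (R - ρ) (R + ρ)
    · have ht0 : 0 < t := by linarith [ht.1]
      have hs : 0 < ρ ^ 2 - (t - R) ^ 2 := by nlinarith [ht.1, ht.2]
      rw [Set.indicator_of_mem ht]
      refine (integral_complex_inv_sqrt (s := ρ ^ 2 - (t - R) ^ 2) ht0).trans ?_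
      rw [if_pos hs]
      ring_nf
    · rw [Set.indicator_of_notMem ht]
      have hs : ρ ^ 2 ≤ (t - R) ^ 2 := by
        rw [sq_le_sq, abs_of_pos hρ, le_abs]
        by_contra! h
        exact ht ⟨by linarith [h.2], by linarith [h.1]⟩
      have : ∀ z : ℂ, ¬ ‖z‖ ^ 2 < ρ ^ 2 - (t - R) ^ 2 := fun z => by nlinarith [sq_nonneg ‖z‖]
      simp [F, this]
  simp_rw [h2]
  rw [integral_indicator measurableSet_Ioo, ← integral_Ioc_eq_integral_Ioo,
    ← intervalIntegral.integral_of_le (by linarith)]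
  have hpos : ∀ t ∈ Set.uIcc (R - ρ) (R + ρ), 0 < ρ ^ 2 - R ^ 2 + 2 * R * t := by
    intro t ht
    rw [Set.uIcc_of_le (by linarith)] at ht
    nlinarith [ht.1, mul_le_mul_of_nonneg_left ht.1 hR.le, sq_pos_of_pos (sub_pos.2 hx)]
  rw [intervalIntegral.integral_eq_sub_of_hasDerivAt
    (f := fun t => 2 * Real.pi * (√(ρ ^ 2 - R ^ 2 + 2 * R * t) ^ 3 / (3 * R) - t ^ 2 / 2))]
  · have e1 : ρ ^ 2 - R ^ 2 + 2 * R * (R + ρ) = (R + ρ) ^ 2 := by ring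
    have e2 : ρ ^ 2 - R ^ 2 + 2 * R * (R - ρ) = (R - ρ) ^ 2 := by ring
    simp only [e1, e2]
    rw [Real.sqrt_sq (by linarith), Real.sqrt_sq (by linarith)]
    field_simp
    ring
  · intro t ht
    have hp := hpos t ht
    have h3 : HasDerivAt (fun t => ρ ^ 2 - R ^ 2 + 2 * R * t) (2 * R * 1) t :=
      ((hasDerivAt_id t).const_mul (2 * R)).const_add _
    have h4 := (((((h3.sqrt hp.ne').pow 3).div_const (3 * R)).sub
      ((hasDerivAt_pow 2 t).div_const 2)).const_mul (2 * Real.pi))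
    refine h4.congr_deriv ?_
    have := Real.sqrt_pos.2 hp
    field_simp
    simp
    ring
  · exact Continuous.intervalIntegrable (by fun_prop) _ _

/-- The negated Lennard-Jones potential `-r⁻¹² + 2 r⁻⁶`. -/
noncomputable def ljPotential (r : ℝ) : ℝ := -r ^ (-12 : ℤ) + 2 * r ^ (-6 : ℤ)

/-- The radius `(11 / 5) ^ (1 / 6)` beyond which `ljPotential` is subharmonic in dimension three. -/
noncomputable def ljRadius : ℝ := (11 / 5 : ℝ) ^ ((1 : ℝ) / 6)

/-- The harmonic continuation of `ljPotential` below `ljRadius`. -/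
noncomputable def ljHarmonic (r : ℝ) : ℝ := 360 / 121 * ljRadius * r⁻¹ - 25 / 11

/-- The subharmonic majorant of `ljPotential`. -/
noncomputable def ljMajorant (r : ℝ) : ℝ := if r ≤ ljRadius then ljHarmonic r else ljPotential r

lemma ljRadius_pos : 0 < ljRadius := by unfold ljRadius; positivity

lemma ljRadius_pow_six : ljRadius ^ 6 = 11 / 5 := by
  rw [ljRadius, ← Real.rpow_natCast, ← Real.rpow_mul (by norm_num)]
  norm_num

lemma ljHarmonic_sub_ljPotential {r : ℝ} (hr : 0 < r) :
    ∃ s : ℝ, 0 ≤ s ∧ ljHarmonic r - ljPotential r = (ljRadius - r) ^ 3 * s := by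
  have hc := ljRadius_pos
  obtain ⟨w, hw⟩ : ∃ w, w = ljRadius / r := ⟨_, rfl⟩
  have hw0 : 0 < w := hw ▸ div_pos hc hr
  have h6 : r ^ (-6 : ℤ) = 5 / 11 * w ^ 6 := by
    rw [hw, div_pow, ljRadius_pow_six, zpow_neg]
    norm_cast
    field_simp
  have h12 : r ^ (-12 : ℤ) = (5 / 11 * w ^ 6) ^ 2 := by
    rw [← h6, ← zpow_natCast, ← zpow_mul]
    norm_num
  have h1 : ljRadius * r⁻¹ = w := by rw [hw, div_eq_mul_inv]
  have h3 : (ljRadius - r) ^ 3 = r ^ 3 * (w - 1) ^ 3 := by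
    rw [← mul_pow, hw, mul_sub, mul_div_cancel₀ _ hr.ne', mul_one]
  refine ⟨(25 * w ^ 9 + 75 * w ^ 8 + 150 * w ^ 7 + 250 * w ^ 6 + 375 * w ^ 5 + 525 * w ^ 4 +
    590 * w ^ 3 + 570 * w ^ 2 + 465 * w + 275) / (121 * r ^ 3), by positivity, ?_⟩
  rw [ljHarmonic, ljPotential, h6, h12, h3, mul_assoc, h1]
  field_simp
  ring

lemma ljPotential_le_ljMajorant {r : ℝ} (hr : 0 < r) : ljPotential r ≤ ljMajorant r := by
  unfold ljMajorant
  split_ifs with h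
  · obtain ⟨s, hs, he⟩ := ljHarmonic_sub_ljPotential hr
    have := mul_nonneg (pow_nonneg (sub_nonneg.2 h) 3) hs
    linarith
  · exact le_rfl

lemma ljHarmonic_le_ljMajorant {r : ℝ} (hr : 0 < r) : ljHarmonic r ≤ ljMajorant r := by
  unfold ljMajorant
  split_ifs with h
  · exact le_rfl
  · obtain ⟨s, hs, he⟩ := ljHarmonic_sub_ljPotential hr
    have := mul_nonneg (pow_nonneg (sub_nonneg.2 (not_le.1 h).le) 3) hs
    nlinarith

lemma ljPotential_ljRadius : ljPotential ljRadius = ljHarmonic ljRadius := by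
  obtain ⟨s, -, he⟩ := ljHarmonic_sub_ljPotential ljRadius_pos
  rw [sub_self, zero_pow three_ne_zero, zero_mul] at he
  linarith

lemma hasDerivAt_mul_ljPotential {r : ℝ} (hr : 0 < r) :
    HasDerivAt (fun s => s * ljPotential s) (11 * (5 / 11 - r ^ (-6 : ℤ)) ^ 2 - 25 / 11) r := by
  have h := (hasDerivAt_id r).mul ((hasDerivAt_zpow (-12) r (Or.inl hr.ne')).neg.add
    ((hasDerivAt_zpow (-6) r (Or.inl hr.ne')).const_mul 2))
  refine h.congr_deriv ?_
  simp only [zpow_neg, Pi.add_apply, Pi.neg_apply, id]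
  norm_num [zpow_neg]
  norm_cast
  field_simp
  ring

lemma monotoneOn_sq_sub_zpow :
    MonotoneOn (fun r : ℝ => 11 * (5 / 11 - r ^ (-6 : ℤ)) ^ 2 - 25 / 11) (Set.Ici ljRadius) := by
  have key : ∀ r ∈ Set.Ici ljRadius, r ^ (-6 : ℤ) ≤ 5 / 11 := by
    intro r hr
    have := pow_le_pow_left₀ ljRadius_pos.le hr 6
    rw [ljRadius_pow_six] at this
    rw [zpow_neg]
    norm_cast
    exact inv_le_of_inv_le₀ (by norm_num) (by linarith)
  intro r hr s hs hrs
  have h1 : s ^ (-6 : ℤ) ≤ r ^ (-6 : ℤ) := by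
    rw [zpow_neg, zpow_neg]
    norm_cast
    exact inv_anti₀ (pow_pos (ljRadius_pos.trans_le hr) 6)
      (pow_le_pow_left₀ (ljRadius_pos.le.trans hr) hrs 6)
  have := pow_le_pow_left₀ (sub_nonneg.2 (key r hr)) (sub_le_sub_left h1 (5 / 11)) 2
  dsimp only
  linarith

lemma mul_ljPotential_tangent_le {R r : ℝ} (hR : ljRadius ≤ R) (hr : ljRadius ≤ r) :
    R * ljPotential R + (11 * (5 / 11 - R ^ (-6 : ℤ)) ^ 2 - 25 / 11) * (r - R) ≤
      r * ljPotential r := by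
  have hpos : ∀ s ∈ Set.Ici ljRadius, 0 < s := fun s hs => ljRadius_pos.trans_le hs
  have hconv : ConvexOn ℝ (Set.Ici ljRadius) (fun s => s * ljPotential s) := by
    refine MonotoneOn.convexOn_of_deriv (convex_Ici _)
      (fun s hs => (hasDerivAt_mul_ljPotential (hpos s hs)).continuousAt.continuousWithinAt)
      (fun s hs => (hasDerivAt_mul_ljPotential
        (hpos s (interior_subset hs))).differentiableAt.differentiableWithinAt) ?_
    refine (monotoneOn_sq_sub_zpow.mono interior_subset).congr fun s hs => ?_
    exact (hasDerivAt_mul_ljPotential (hpos s (interior_subset hs))).deriv.symm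
  have hd := hasDerivAt_mul_ljPotential (hpos R hR)
  rcases lt_trichotomy R r with h | rfl | h
  · have := hconv.le_slope_of_hasDerivAt hR hr h hd
    rw [slope_def_field, le_div_iff₀ (sub_pos.2 h)] at this
    linarith
  · simp
  · have := hconv.slope_le_of_hasDerivAt hr hR h hd
    rw [slope_def_field, div_le_iff₀ (sub_pos.2 h)] at this
    linarith

lemma exists_add_mul_inv_le_ljMajorant {R : ℝ} (hR : 0 < R) :
    ∃ A B : ℝ, ljMajorant R = A + B * R⁻¹ ∧ ∀ r, 0 < r → A + B * r⁻¹ ≤ ljMajorant r := by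
  rcases le_or_gt R ljRadius with h | h
  · refine ⟨-25 / 11, 360 / 121 * ljRadius, ?_, fun r hr => ?_⟩
    · rw [ljMajorant, if_pos h, ljHarmonic]; ring
    · refine le_trans (le_of_eq ?_) (ljHarmonic_le_ljMajorant hr)
      rw [ljHarmonic]; ring
  · obtain ⟨m, hm⟩ : ∃ m : ℝ, m = 11 * (5 / 11 - R ^ (-6 : ℤ)) ^ 2 - 25 / 11 := ⟨_, rfl⟩
    refine ⟨m, R * ljPotential R - m * R, ?_, fun r hr => ?_⟩
    · rw [ljMajorant, if_neg h.not_ge]; field_simp; ring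
    · suffices H : R * ljPotential R + m * (r - R) ≤ r * ljMajorant r by
        refine le_of_mul_le_mul_left ?_ hr
        refine le_trans (le_of_eq ?_) H
        field_simp
        ring
      rcases le_or_gt r ljRadius with hrc | hrc
      · have h1 := mul_ljPotential_tangent_le h.le (le_refl ljRadius)
        rw [← hm, ljPotential_ljRadius, ljHarmonic] at h1
        have hm' : -25 / 11 ≤ m := by
          rw [hm]; nlinarith [sq_nonneg (5 / 11 - R ^ (-6 : ℤ))]
        have h2 := mul_le_mul_of_nonneg_right hm' (sub_nonneg.2 hrc)
        rw [ljMajorant, if_pos hrc, ljHarmonic]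
        have h3 : r * (360 / 121 * ljRadius * r⁻¹ - 25 / 11) =
          360 / 121 * ljRadius - 25 / 11 * r := by field_simp
        have h4 : ljRadius * (360 / 121 * ljRadius * ljRadius⁻¹ - 25 / 11) =
          360 / 121 * ljRadius - 25 / 11 * ljRadius := by
            have := ljRadius_pos.ne'
            field_simp
        rw [h3]
        rw [h4] at h1
        linarith
      · have h1 := mul_ljPotential_tangent_le h.le hrc.le
        rw [ljMajorant, if_neg hrc.not_ge, hm]
        exact h1

lemma ljMajorant_nonneg {r : ℝ} (hr : 0 < r) : 0 ≤ ljMajorant r := by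
  have hc := ljRadius_pos
  unfold ljMajorant
  split_ifs with h
  · have : 1 ≤ ljRadius * r⁻¹ := by rwa [← div_eq_mul_inv, one_le_div hr]
    rw [ljHarmonic, mul_assoc]
    linarith
  · have h6 := pow_lt_pow_left₀ (not_le.1 h) hc.le (n := 6) (by norm_num)
    rw [ljRadius_pow_six] at h6
    have : ljPotential r = (r ^ 12)⁻¹ * (2 * r ^ 6 - 1) := by
      rw [ljPotential, zpow_neg, zpow_neg]
      norm_cast
      field_simp
      ring
    rw [this]
    exact mul_nonneg (by positivity) (by linarith)

lemma ljPotential_nonpos {r : ℝ} (hr : 0 < r) (hr' : r ≤ 0.89) : ljPotential r ≤ 0 := by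
  have h6 : r ^ 6 ≤ 0.89 ^ 6 := pow_le_pow_left₀ hr.le hr' 6
  have : ljPotential r = (r ^ 12)⁻¹ * (2 * r ^ 6 - 1) := by
    rw [ljPotential, zpow_neg, zpow_neg]
    norm_cast
    field_simp
    ring
  rw [this]
  exact mul_nonpos_of_nonneg_of_nonpos (by positivity) (by norm_num at h6; linarith)

lemma hasDerivAt_ljPotential_tail {w : ℝ} (hw : 0 < w) :
    HasDerivAt (fun w : ℝ => (w ^ 9)⁻¹ / 9 - 2 / 3 * (w ^ 3)⁻¹) (ljPotential w * w ^ 2) w := by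
  have h := (((hasDerivAt_pow 9 w).inv (pow_ne_zero 9 hw.ne')).div_const 9).sub
    (((hasDerivAt_pow 3 w).inv (pow_ne_zero 3 hw.ne')).const_mul (2 / 3))
  refine h.congr_deriv ?_
  rw [ljPotential, zpow_neg, zpow_neg]
  norm_cast
  field_simp
  ring

lemma tendsto_ljPotential_tail :
    Filter.Tendsto (fun w : ℝ => (w ^ 9)⁻¹ / 9 - 2 / 3 * (w ^ 3)⁻¹) Filter.atTop (nhds 0) := by
  have h (n : ℕ) (hn : n ≠ 0) : Filter.Tendsto (fun w : ℝ => (w ^ n)⁻¹) Filter.atTop (nhds 0) :=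
    (Filter.tendsto_pow_atTop hn).inv_tendsto_atTop
  simpa using ((h 9 (by norm_num)).div_const 9).sub ((h 3 (by norm_num)).const_mul (2 / 3))

lemma ljPotential_mul_sq_nonneg {w : ℝ} (hw : w ∈ Set.Ioi ljRadius) :
    0 ≤ ljPotential w * w ^ 2 := by
  have h := ljMajorant_nonneg (ljRadius_pos.trans hw)
  rw [ljMajorant, if_neg (not_le.2 hw)] at h
  positivity

lemma lt_ljRadius : 0.54 < ljRadius := by
  refine lt_of_pow_lt_pow_left₀ 6 ljRadius_pos.le ?_
  rw [ljRadius_pow_six]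
  norm_num

lemma integrableOn_ljMajorant_Ioc :
    IntegrableOn (fun w => ljMajorant w * w ^ 2) (Set.Ioc 0.54 ljRadius) := by
  refine IntegrableOn.congr_fun (f := fun w => 360 / 121 * ljRadius * w - 25 / 11 * w ^ 2)
    ?_ (fun w hw => ?_) measurableSet_Ioc
  · exact (Continuous.integrableOn_Icc (by fun_prop)).mono_set Set.Ioc_subset_Icc_self
  · have : 0 < w := lt_trans (by norm_num) hw.1
    rw [ljMajorant, if_pos hw.2, ljHarmonic]
    field_simp

lemma integrableOn_ljMajorant_Ioi_ljRadius :
    IntegrableOn (fun w => ljMajorant w * w ^ 2) (Set.Ioi ljRadius) := by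
  refine IntegrableOn.congr_fun (f := fun w => ljPotential w * w ^ 2)
    ?_ (fun w hw => ?_) measurableSet_Ioi
  · exact integrableOn_Ioi_deriv_of_nonneg'
      (fun w hw => hasDerivAt_ljPotential_tail (ljRadius_pos.trans_le hw))
      (fun w hw => ljPotential_mul_sq_nonneg hw) tendsto_ljPotential_tail
  · dsimp only
    rw [ljMajorant, if_neg (not_le.2 hw)]

lemma integrableOn_ljMajorant :
    IntegrableOn (fun w => ljMajorant w * w ^ 2) (Set.Ioi 0.54) := by
  rw [← Set.Ioc_union_Ioi_eq_Ioi lt_ljRadius.le]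
  exact integrableOn_ljMajorant_Ioc.union integrableOn_ljMajorant_Ioi_ljRadius

lemma integral_ljMajorant_Ioc :
    ∫ w in Set.Ioc 0.54 ljRadius, ljMajorant w * w ^ 2 =
      180 / 121 * ljRadius * (ljRadius ^ 2 - 0.54 ^ 2) - 25 / 33 * (ljRadius ^ 3 - 0.54 ^ 3) := by
  have h : ∫ w in Set.Ioc 0.54 ljRadius, ljMajorant w * w ^ 2 =
      ∫ w in Set.Ioc 0.54 ljRadius, (360 / 121 * ljRadius * w - 25 / 11 * w ^ 2) := by
    refine setIntegral_congr_fun measurableSet_Ioc fun w hw => ?_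
    have : 0 < w := lt_trans (by norm_num) hw.1
    rw [ljMajorant, if_pos hw.2, ljHarmonic]
    field_simp
  rw [h, ← intervalIntegral.integral_of_le lt_ljRadius.le, intervalIntegral.integral_sub
    (Continuous.intervalIntegrable (by fun_prop) _ _)
    (Continuous.intervalIntegrable (by fun_prop) _ _), intervalIntegral.integral_const_mul,
    intervalIntegral.integral_const_mul, integral_id, integral_pow]
  ring

lemma integral_ljMajorant_Ioi_ljRadius :
    ∫ w in Set.Ioi ljRadius, ljMajorant w * w ^ 2 =
      2 / 3 * (ljRadius ^ 3)⁻¹ - (ljRadius ^ 9)⁻¹ / 9 := by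
  have h : ∫ w in Set.Ioi ljRadius, ljMajorant w * w ^ 2 =
      ∫ w in Set.Ioi ljRadius, ljPotential w * w ^ 2 := by
    refine setIntegral_congr_fun measurableSet_Ioi fun w hw => ?_
    rw [ljMajorant, if_neg (not_le.2 hw)]
  rw [h, integral_Ioi_of_hasDerivAt_of_nonneg'
    (fun w hw => hasDerivAt_ljPotential_tail (ljRadius_pos.trans_le hw))
    (fun w hw => ljPotential_mul_sq_nonneg hw) tendsto_ljPotential_tail]
  ring

lemma integral_ljMajorant_lt :
    24 * ∫ w in Set.Ioi (0.54 : ℝ), ljMajorant w * w ^ 2 < 26.95 := by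
  have hc := ljRadius_pos
  have h6 := ljRadius_pow_six
  have hcl : 1.1404 < ljRadius := by
    refine lt_of_pow_lt_pow_left₀ 6 hc.le ?_
    rw [h6]
    norm_num
  have hcu : ljRadius ^ 3 < 1.48325 := by
    refine lt_of_pow_lt_pow_left₀ 2 (by norm_num) ?_
    rw [← pow_mul, h6]
    norm_num
  have h3 : (ljRadius ^ 3)⁻¹ = 5 / 11 * ljRadius ^ 3 := by
    refine inv_eq_of_mul_eq_one_right ?_
    linear_combination 5 / 11 * h6
  have h9 : (ljRadius ^ 9)⁻¹ = 25 / 121 * ljRadius ^ 3 := by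
    refine inv_eq_of_mul_eq_one_right ?_
    linear_combination (25 / 121 * ljRadius ^ 6 + 5 / 11) * h6
  rw [← Set.Ioc_union_Ioi_eq_Ioi lt_ljRadius.le, setIntegral_union
    (Set.Ioc_disjoint_Ioi le_rfl) measurableSet_Ioi integrableOn_ljMajorant_Ioc
    integrableOn_ljMajorant_Ioi_ljRadius, integral_ljMajorant_Ioc,
    integral_ljMajorant_Ioi_ljRadius, h3, h9]
  norm_num at hcl hcu ⊢
  nlinarith

/-- `ljMajorant` restricted to the radii reached by the balls around the far points. -/
noncomputable def ljCutoff : ℝ → ℝ := (Set.Ioi 0.54).indicator ljMajorant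

lemma ljCutoff_nonneg (r : ℝ) : 0 ≤ ljCutoff r :=
  Set.indicator_nonneg (fun _ hr => ljMajorant_nonneg (lt_trans (by norm_num) hr)) r

lemma sq_smul_ljCutoff (r : ℝ) :
    r ^ 2 • ljCutoff r = (Set.Ioi 0.54).indicator (fun w => ljMajorant w * w ^ 2) r := by
  rw [ljCutoff, Set.indicator_apply, Set.indicator_apply]
  split_ifs <;> simp [mul_comm]

lemma integrable_ljCutoff_norm :
    Integrable (fun y : EuclideanSpace ℝ (Fin 3) => ljCutoff ‖y‖) := by
  rw [integrable_fun_norm_addHaar volume (f := ljCutoff), finrank_euclideanSpace_fin]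
  simp_rw [Nat.reduceSub, sq_smul_ljCutoff]
  exact ((integrable_indicator_iff measurableSet_Ioi).2 integrableOn_ljMajorant).integrableOn

lemma volume_real_ball_fin_three (x : EuclideanSpace ℝ (Fin 3)) {ρ : ℝ} (hρ : 0 ≤ ρ) :
    (volume : Measure (EuclideanSpace ℝ (Fin 3))).real (Metric.ball x ρ) =
      4 / 3 * Real.pi * ρ ^ 3 := by
  rw [Measure.real, EuclideanSpace.volume_ball_fin_three, ENNReal.toReal_mul, ENNReal.toReal_pow,
    ENNReal.toReal_ofReal hρ, ENNReal.toReal_ofReal (by positivity)]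
  ring

lemma integral_ljCutoff_norm :
    ∫ y : EuclideanSpace ℝ (Fin 3), ljCutoff ‖y‖ =
      4 * Real.pi * ∫ w in Set.Ioi (0.54 : ℝ), ljMajorant w * w ^ 2 := by
  rw [integral_fun_norm_addHaar volume ljCutoff, finrank_euclideanSpace_fin,
    volume_real_ball_fin_three 0 zero_le_one]
  simp_rw [Nat.reduceSub, sq_smul_ljCutoff]
  rw [setIntegral_indicator measurableSet_Ioi, Set.Ioi_inter_Ioi]
  norm_num
  ring

lemma ljMajorant_mul_le_setIntegral_ball {x : EuclideanSpace ℝ (Fin 3)} {ρ : ℝ} (hρ : 0 < ρ)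
    (hx : ρ + 0.54 ≤ ‖x‖) :
    ljMajorant ‖x‖ * (4 / 3 * Real.pi * ρ ^ 3) ≤ ∫ y in Metric.ball x ρ, ljCutoff ‖y‖ := by
  have hρx : ρ < ‖x‖ := lt_of_lt_of_le (by norm_num) hx
  obtain ⟨A, B, hAB, hle⟩ := exists_add_mul_inv_le_ljMajorant (hρ.trans hρx)
  have hint := (integrableOn_ball_inv_norm hρx).const_mul B
  have hconst : IntegrableOn (fun _ : EuclideanSpace ℝ (Fin 3) => A) (Metric.ball x ρ) :=
    integrableOn_const measure_ball_lt_top.ne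
  have h1 : ∫ y in Metric.ball x ρ, (A + B * ‖y‖⁻¹) =
      ljMajorant ‖x‖ * (4 / 3 * Real.pi * ρ ^ 3) := by
    rw [integral_add hconst hint, integral_const_mul, setIntegral_ball_inv_norm hρ hρx,
      setIntegral_const, volume_real_ball_fin_three x hρ.le, hAB, smul_eq_mul]
    ring
  rw [← h1]
  refine setIntegral_mono_on (hconst.add hint) integrable_ljCutoff_norm.integrableOn
    measurableSet_ball fun y hy => ?_
  have hy' : 0.54 < ‖y‖ := by
    rw [mem_ball_iff_norm'] at hy
    have := norm_sub_norm_le x y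
    linarith
  rw [ljCutoff, Set.indicator_of_mem (Set.mem_Ioi.2 hy')]
  exact hle _ (lt_trans (by norm_num) hy')

lemma sum_ljPotential_norm_le {a : ℝ} (ha : 0 < a) (ha' : a ≤ 0.7)
    (Q : Finset (EuclideanSpace ℝ (Fin 3)))
    (hQ : ∀ x ∈ Q, ∀ y ∈ Q, x ≠ y → a ≤ dist x y) (hQ0 : ∀ x ∈ Q, a ≤ ‖x‖) :
    ∑ x ∈ Q, ljPotential ‖x‖ ≤
      24 / a ^ 3 * ∫ w in Set.Ioi (0.54 : ℝ), ljMajorant w * w ^ 2 := by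
  have hsplit : ∑ x ∈ Q, ljPotential ‖x‖ ≤ ∑ x ∈ Q with 0.89 < ‖x‖, ljMajorant ‖x‖ := by
    rw [Finset.sum_filter]
    refine Finset.sum_le_sum fun x hx => ?_
    have hx0 : 0 < ‖x‖ := ha.trans_le (hQ0 x hx)
    split_ifs with h
    · exact ljPotential_le_ljMajorant hx0
    · exact ljPotential_nonpos hx0 (not_lt.1 h)
  have hballs : (∑ x ∈ Q with 0.89 < ‖x‖, ljMajorant ‖x‖) * (4 / 3 * Real.pi * (a / 2) ^ 3) ≤
      ∫ y : EuclideanSpace ℝ (Fin 3), ljCutoff ‖y‖ := by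
    rw [Finset.sum_mul]
    calc ∑ x ∈ Q with 0.89 < ‖x‖, ljMajorant ‖x‖ * (4 / 3 * Real.pi * (a / 2) ^ 3)
        ≤ ∑ x ∈ Q with 0.89 < ‖x‖, ∫ y in Metric.ball x (a / 2), ljCutoff ‖y‖ := by
          refine Finset.sum_le_sum fun x hx => ?_
          have := (Finset.mem_filter.1 hx).2
          refine ljMajorant_mul_le_setIntegral_ball (half_pos ha) ?_
          norm_num at ha' this ⊢
          linarith
      _ = ∫ y in ⋃ x ∈ Q.filter (fun x => 0.89 < ‖x‖), Metric.ball x (a / 2),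
            ljCutoff ‖y‖ := by
          refine (integral_biUnion_finset _ (fun _ _ => measurableSet_ball) ?_
            fun _ _ => integrable_ljCutoff_norm.integrableOn).symm
          intro x hx y hy hxy
          refine Metric.ball_disjoint_ball ?_
          rw [add_halves]
          exact hQ x (Finset.mem_filter.1 hx).1 y (Finset.mem_filter.1 hy).1 hxy
      _ ≤ ∫ y : EuclideanSpace ℝ (Fin 3), ljCutoff ‖y‖ :=
          setIntegral_le_integral integrable_ljCutoff_norm
            (Filter.Eventually.of_forall fun _ => ljCutoff_nonneg _)
  rw [integral_ljCutoff_norm] at hballs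
  refine hsplit.trans (le_of_mul_le_mul_right (hballs.trans (le_of_eq ?_))
    (by positivity : 0 < 4 / 3 * Real.pi * (a / 2) ^ 3))
  field_simp
  ring

theorem stmt_14 (h θ : ℝ → ℝ)
    (hh : ∀ r : ℝ, 0 < r → h r = -r ^ (-12 : ℤ) + 2 * r ^ (-6 : ℤ))
    (hθ₁ : ∀ r : ℝ, 0 < r → r ≤ (11/5 : ℝ) ^ ((1:ℝ)/6) →
      θ r = (360/121) * (11/5 : ℝ) ^ ((1:ℝ)/6) * r⁻¹ - 25/11)
    (hθ₂ : ∀ r : ℝ, (11/5 : ℝ) ^ ((1:ℝ)/6) < r → θ r = -r ^ (-12 : ℤ) + 2 * r ^ (-6 : ℤ))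
    (a : ℝ) (ha : 0 < a) (ha' : a ≤ 0.7)
    (Q : Finset (EuclideanSpace ℝ (Fin 3)))
    (hQ : ∀ x ∈ Q, ∀ y ∈ Q, x ≠ y → a ≤ dist x y)
    (hQ0 : ∀ x ∈ Q, a ≤ ‖x‖) :
    (∑ x ∈ Q, h ‖x‖) ≤ (24 / a ^ 3) * ∫ w in Set.Ioi (0.54 : ℝ), θ w * w ^ 2 ∧
    (24 / a ^ 3) * ∫ w in Set.Ioi (0.54 : ℝ), θ w * w ^ 2 < 26.95 / a ^ 3 := by
  have hint : ∫ w in Set.Ioi (0.54 : ℝ), θ w * w ^ 2 =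
      ∫ w in Set.Ioi (0.54 : ℝ), ljMajorant w * w ^ 2 := by
    refine setIntegral_congr_fun measurableSet_Ioi fun w hw => ?_
    have hw0 : 0 < w := lt_trans (by norm_num) hw
    congr 1
    rcases le_or_gt w ljRadius with h | h
    · rw [ljMajorant, if_pos h]
      exact hθ₁ w hw0 h
    · rw [ljMajorant, if_neg h.not_ge]
      exact hθ₂ w h
  rw [hint]
  constructor
  · rw [Finset.sum_congr rfl fun x hx => hh ‖x‖ (ha.trans_le (hQ0 x hx))]
    exact sum_ljPotential_norm_le ha ha' Q hQ hQ0
  · rw [div_mul_eq_mul_div]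
    exact div_lt_div_of_pos_right integral_ljMajorant_lt (pow_pos ha 3)
end
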